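/- arXiv:2008.12406 — 3 statements merged into one kernel-verified Lean document; each statement's English description precedes it below -/
import Mathlib

section
/- Let n ≥ 1 and p ∈ ℕ, and let P be a harmonic polynomial in n real variables that is homogeneous of degree p, regarded (after complexifying scalars) as a function ℝⁿ → ℂ. Then for every ξ ∈ ℝⁿ, ∫_{ℝⁿ} P(x) · exp(−π‖x‖²) · exp(−2πi⟨x,ξ⟩) dx = (−i)^p · P(ξ) · exp(−π‖ξ‖²), where the integral is with respect to Lebesgue measure on ℝⁿ, ‖·‖ is the Euclidean norm and ⟨·,·⟩ the Euclidean inner product. (Note (−i)^p = i^{−p}.) -/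
open MeasureTheory MvPolynomial

/-- The standard Gaussian on `ℝⁿ` times the character `x ↦ exp(−2πi⟨x,ξ⟩)`. -/
noncomputable def gaussianChar {n : ℕ} (ξ x : Fin n → ℝ) : ℂ :=
  Complex.exp (-(Real.pi : ℂ) * ((∑ i, x i ^ 2 : ℝ) : ℂ)) *
    Complex.exp (-(2 * (Real.pi : ℂ) * ((∑ i, x i * ξ i : ℝ) : ℂ)) * Complex.I)

lemma MvPolynomial.hasLineDerivAt_eval {n : ℕ} (q : MvPolynomial (Fin n) ℝ) (j : Fin n)
    (x : Fin n → ℝ) :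
    HasLineDerivAt ℝ (fun y ↦ eval y q) (eval x (pderiv j q)) x (Pi.single j 1) := by
  unfold HasLineDerivAt
  induction q using MvPolynomial.induction_on with
  | C a => simpa using hasDerivAt_const (0 : ℝ) a
  | add p q hp hq => simpa using hp.fun_add hq
  | mul_X p i hp =>
    have hX : HasDerivAt (fun t : ℝ ↦ x i + t * (Pi.single j 1 : Fin n → ℝ) i)
        ((Pi.single j 1 : Fin n → ℝ) i) 0 := by
      simpa using ((hasDerivAt_id (0 : ℝ)).mul_const _).const_add (x i)
    have h := hp.fun_mul hX
    simp only [zero_smul, add_zero, zero_mul] at h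
    simp only [map_mul, eval_X, Pi.add_apply, Pi.smul_apply, smul_eq_mul]
    refine h.congr_deriv ?_
    obtain rfl | hij := eq_or_ne i j
    · simp [mul_comm, add_comm]
    · simp [pderiv_X_of_ne hij, hij, mul_comm]

lemma hasLineDerivAt_gaussianChar {n : ℕ} (ξ x : Fin n → ℝ) (j : Fin n) :
    HasLineDerivAt ℝ (gaussianChar ξ)
      (-(2 * (Real.pi : ℂ)) * (x j + ξ j * Complex.I) * gaussianChar ξ x) x (Pi.single j 1) := by
  unfold HasLineDerivAt gaussianChar
  have hX (i : Fin n) : HasDerivAt (fun t : ℝ ↦ (x + t • (Pi.single j 1 : Fin n → ℝ)) i)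
      ((Pi.single j 1 : Fin n → ℝ) i) 0 := by
    simpa using ((hasDerivAt_id (0 : ℝ)).mul_const _).const_add (x i)
  have h₁ := (HasDerivAt.fun_sum fun i (_ : i ∈ Finset.univ) ↦ (hX i).fun_pow 2).ofReal_comp
  have h₂ := (HasDerivAt.fun_sum fun i (_ : i ∈ Finset.univ) ↦
    (hX i).mul_const (ξ i)).ofReal_comp
  have h := (h₁.const_mul (-(Real.pi : ℂ))).cexp.mul
    (((h₂.const_mul (2 * (Real.pi : ℂ))).neg.mul_const Complex.I).cexp)
  refine h.congr_deriv ?_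
  simp [Pi.single_apply]
  ring

lemma integrable_pow_mul_exp_neg_pi_mul_sq (k : ℕ) :
    Integrable fun x : ℝ ↦ x ^ k * Real.exp (-Real.pi * x ^ 2) := by
  simpa using integrable_rpow_mul_exp_neg_mul_sq Real.pi_pos (s := k)
    (by linarith [k.cast_nonneg (α := ℝ)])

lemma MvPolynomial.integrable_eval_mul_exp_neg_pi {n : ℕ} (q : MvPolynomial (Fin n) ℝ) :
    Integrable fun x : Fin n → ℝ ↦ eval x q * Real.exp (-Real.pi * ∑ i, x i ^ 2) := by
  induction q using MvPolynomial.induction_on' with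
  | monomial s a =>
    have h := (Integrable.fintype_prod (μ := fun _ : Fin n ↦ volume) fun i ↦
      integrable_pow_mul_exp_neg_pi_mul_sq (s i)).const_mul a
    refine h.congr (.of_forall fun x ↦ ?_)
    simp only [eval_monomial, Finset.prod_mul_distrib, Finset.mul_sum, Real.exp_sum,
      Finsupp.prod_fintype _ _ fun i ↦ pow_zero (x i)]
    ring
  | add p q hp hq => simpa [add_mul] using! hp.add hq

lemma MvPolynomial.integrable_eval_mul_gaussianChar {n : ℕ} (ξ : Fin n → ℝ)
    (q : MvPolynomial (Fin n) ℝ) :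
    Integrable fun x : Fin n → ℝ ↦ (eval x q : ℂ) * gaussianChar ξ x := by
  have h := q.integrable_eval_mul_exp_neg_pi.ofReal (𝕜 := ℂ)
  refine (h.mul_bdd (c := 1) (g := fun x ↦
    Complex.exp (-(2 * (Real.pi : ℂ) * ((∑ i, x i * ξ i : ℝ) : ℂ)) * Complex.I))
    (Continuous.aestronglyMeasurable (by fun_prop)) (.of_forall fun x ↦ ?_)).congr
    (.of_forall fun x ↦ ?_)
  · rw [Complex.norm_exp]
    simp [-Complex.ofReal_sum]
  · simp [gaussianChar, mul_assoc]

/-- The integral of a polynomial against `gaussianChar ξ`, as a linear functional. -/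
noncomputable def gaussianFourier {n : ℕ} (ξ : Fin n → ℝ) : MvPolynomial (Fin n) ℝ →ₗ[ℝ] ℂ where
  toFun q := ∫ x : Fin n → ℝ, (eval x q : ℂ) * gaussianChar ξ x
  map_add' p q := by
    simp only [map_add, Complex.ofReal_add, add_mul]
    exact integral_add (p.integrable_eval_mul_gaussianChar ξ) (q.integrable_eval_mul_gaussianChar ξ)
  map_smul' c q := by
    simp [mul_assoc, integral_const_mul]

lemma gaussianFourier_apply {n : ℕ} (ξ : Fin n → ℝ) (q : MvPolynomial (Fin n) ℝ) :
    gaussianFourier ξ q = ∫ x : Fin n → ℝ, (eval x q : ℂ) * gaussianChar ξ x := rfl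

lemma gaussianFourier_X_mul {n : ℕ} (ξ : Fin n → ℝ) (j : Fin n) (q : MvPolynomial (Fin n) ℝ) :
    gaussianFourier ξ (X j * q) =
      -Complex.I * ξ j * gaussianFourier ξ q
        + 1 / (2 * Real.pi) * gaussianFourier ξ (pderiv j q) := by
  have hq := q.integrable_eval_mul_gaussianChar ξ
  have hXq := (X j * q).integrable_eval_mul_gaussianChar ξ
  have hfun (x : Fin n → ℝ) : (eval x q : ℂ) *
      (-(2 * (Real.pi : ℂ)) * (x j + ξ j * Complex.I) * gaussianChar ξ x) =
      -(2 * (Real.pi : ℂ)) * ((eval x (X j * q) : ℂ) * gaussianChar ξ x) +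
      -(2 * (Real.pi : ℂ)) * (ξ j * Complex.I) * ((eval x q : ℂ) * gaussianChar ξ x) := by
    simp
    ring
  have h := integral_bilinear_hasLineDerivAt_right_eq_neg_left_of_integrable
    (μ := (volume : Measure (Fin n → ℝ))) (B := ContinuousLinearMap.mul ℝ ℂ)
    (v := Pi.single j 1) (f := fun x ↦ (eval x q : ℂ)) (f' := fun x ↦ (eval x (pderiv j q) : ℂ))
    (g := gaussianChar ξ)
    (g' := fun x ↦ -(2 * (Real.pi : ℂ)) * (x j + ξ j * Complex.I) * gaussianChar ξ x)
    (by simpa using (pderiv j q).integrable_eval_mul_gaussianChar ξ)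
    (by
      simp only [ContinuousLinearMap.mul_apply', hfun]
      exact (hXq.const_mul _).add (hq.const_mul _))
    (by simpa using hq)
    (fun x _ ↦ HasDerivAt.ofReal_comp (q.hasLineDerivAt_eval j x))
    (fun x _ ↦ hasLineDerivAt_gaussianChar ξ x j)
  simp only [ContinuousLinearMap.mul_apply', hfun] at h
  rw [integral_add (hXq.const_mul _) (hq.const_mul _), integral_const_mul, integral_const_mul,
    ← gaussianFourier_apply, ← gaussianFourier_apply, ← gaussianFourier_apply] at h
  have hpi : (Real.pi : ℂ) ≠ 0 := by exact_mod_cast Real.pi_ne_zero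
  field_simp
  linear_combination -h

lemma gaussianFourier_one {n : ℕ} (ξ : Fin n → ℝ) :
    gaussianFourier ξ 1 = Complex.exp (-(Real.pi : ℂ) * ((∑ i, ξ i ^ 2 : ℝ) : ℂ)) := by
  have hpi : (Real.pi : ℂ) ≠ 0 := by exact_mod_cast Real.pi_ne_zero
  have h := GaussianFourier.integral_cexp_neg_mul_sum_add (b := Real.pi)
    (by simpa using Real.pi_pos) fun i ↦ -(2 * (Real.pi : ℂ) * ξ i) * Complex.I
  rw [div_self hpi, Complex.one_cpow, one_mul] at h
  rw [gaussianFourier_apply]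
  convert h using 1
  · congr with x
    simp only [gaussianChar, map_one, Complex.ofReal_one, one_mul, ← Complex.exp_add]
    congr 1
    push_cast
    simp only [Finset.mul_sum, Finset.sum_mul, ← Finset.sum_neg_distrib]
    congr 1
    refine Finset.sum_congr rfl fun i _ ↦ ?_
    ring
  · congr 1
    push_cast
    rw [eq_div_iff (by simp), Finset.mul_sum, Finset.sum_mul]
    refine Finset.sum_congr rfl fun i _ ↦ ?_
    rw [mul_pow, Complex.I_sq]
    ring

lemma MvPolynomial.pderiv_pderiv_comm {σ R : Type*} [CommSemiring R] (i j : σ)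
    (q : MvPolynomial σ R) : pderiv i (pderiv j q) = pderiv j (pderiv i q) := by
  classical
  induction q using MvPolynomial.induction_on with
  | C a => simp
  | add p q hp hq => simp [hp, hq]
  | mul_X p k hp =>
    simp only [pderiv_mul, map_add, hp, pderiv_X, Pi.single_apply]
    split_ifs <;> simp [add_comm, add_left_comm]

lemma gaussianFourier_eq_of_harmonic {n : ℕ} (ξ : Fin n → ℝ) (p : ℕ)
    (P : MvPolynomial (Fin n) ℝ) (hharm : ∑ j, pderiv j (pderiv j P) = 0)
    (hhom : P.IsHomogeneous p) :
    gaussianFourier ξ P = (-Complex.I) ^ p * (eval ξ P : ℂ) * gaussianFourier ξ 1 := by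
  induction p generalizing P with
  | zero =>
    obtain ⟨a, rfl⟩ : ∃ a, P = C a := ⟨_, totalDegree_eq_zero_iff_eq_C.mp
      (hhom.totalDegree_le |> Nat.le_zero.mp)⟩
    rw [← mul_one (C a), ← smul_eq_C_mul, map_smul]
    simp
  | succ p ih =>
    have hderiv (j : Fin n) : gaussianFourier ξ (pderiv j P) =
        (-Complex.I) ^ p * (eval ξ (pderiv j P) : ℂ) * gaussianFourier ξ 1 := by
      refine ih _ ?_ hhom.pderiv
      rw [← map_zero (pderiv j), ← hharm, map_sum]
      refine Finset.sum_congr rfl fun i _ ↦ ?_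
      rw [pderiv_pderiv_comm i j P, pderiv_pderiv_comm i j]
    have heval := congrArg (fun q ↦ (eval ξ q : ℂ)) hhom.sum_X_mul_pderiv
    have hL := congrArg (gaussianFourier ξ) hhom.sum_X_mul_pderiv
    simp only [map_sum, gaussianFourier_X_mul, Finset.sum_add_distrib, ← Finset.mul_sum,
      ← Nat.cast_smul_eq_nsmul ℝ, map_smul, Complex.real_smul, Complex.ofReal_natCast] at hL
    rw [← map_sum, hharm, map_zero, mul_zero, add_zero] at hL
    simp only [map_sum, map_mul, eval_X, nsmul_eq_mul, Complex.ofReal_sum,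
      Complex.ofReal_mul, map_natCast, Complex.ofReal_natCast] at heval
    have hp : ((p + 1 : ℕ) : ℂ) ≠ 0 := Nat.cast_ne_zero.mpr p.succ_ne_zero
    apply mul_left_cancel₀ hp
    calc _ = _ := hL.symm
      _ = (-Complex.I) ^ (p + 1) * (∑ j, (ξ j : ℂ) * (eval ξ (pderiv j P) : ℂ)) *
          gaussianFourier ξ 1 := by
        simp only [hderiv, Finset.mul_sum, Finset.sum_mul]
        refine Finset.sum_congr rfl fun j _ ↦ ?_
        ring
      _ = _ := by
        rw [heval]
        ring

/-- **Hecke's identity over ℝ.** If `P` is a harmonic polynomial in `n` real variables,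
homogeneous of degree `p`, then for every `ξ ∈ ℝⁿ`,
`∫_{ℝⁿ} P(x) · exp(−π‖x‖²) · exp(−2πi⟨x,ξ⟩) dx = (−i)^p · P(ξ) · exp(−π‖ξ‖²)`. -/
theorem hecke_identity_real (n p : ℕ) (hn : 1 ≤ n)
    (P : MvPolynomial (Fin n) ℝ)
    (hharm : ∑ j : Fin n, pderiv j (pderiv j P) = 0)
    (hhom : P.IsHomogeneous p) (ξ : Fin n → ℝ) :
    (∫ x : Fin n → ℝ,
        (MvPolynomial.eval x P : ℂ) *
          Complex.exp (-(Real.pi : ℂ) * ((∑ i, x i ^ 2 : ℝ) : ℂ)) *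
          Complex.exp (-(2 * (Real.pi : ℂ) * ((∑ i, x i * ξ i : ℝ) : ℂ)) * Complex.I))
      = (-Complex.I) ^ p * (MvPolynomial.eval ξ P : ℂ) *
          Complex.exp (-(Real.pi : ℂ) * ((∑ i, ξ i ^ 2 : ℝ) : ℂ)) := by
  rw [← gaussianFourier_one, ← gaussianFourier_eq_of_harmonic ξ p P hharm hhom,
    gaussianFourier_apply]
  simp only [gaussianChar, mul_assoc]
end

section
/- Let n ≥ 2 and p, q ∈ ℕ. The complex vector space H_{p,q}(ℂⁿ) of harmonic polynomials of bidegree (p,q) has finite dimension d satisfying (n−1)·d = (p+q+n−1)·C(p+n−2, n−2)·C(q+n−2, n−2); that is, d = ((p+q+n−1)/(n−1))·C(p+n−2, n−2)·C(q+n−2, n−2). -/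
open MvPolynomial

/-- The mixed Laplacian `∑_j ∂²/∂u_j∂v_j` on polynomials in `2n` complex variables
(the first block standing for `z₁,…,zₙ`, the second for `conj z₁,…,conj zₙ`),
as a linear map. -/
noncomputable def mixedLaplacianC (n : ℕ) :
    MvPolynomial (Fin n ⊕ Fin n) ℂ →ₗ[ℂ] MvPolynomial (Fin n ⊕ Fin n) ℂ :=
  ∑ j : Fin n, ((pderiv (Sum.inl j)).toLinearMap ∘ₗ (pderiv (Sum.inr j)).toLinearMap)

/-- `H_{p,q}(ℂⁿ)`: the space of harmonic polynomials of bidegree `(p,q)`, realized as the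
space of polynomials `Q` in `2n` variables that are homogeneous of degree `p` in the first
block, homogeneous of degree `q` in the second block, and satisfy `∑_j ∂²Q/∂u_j∂v_j = 0`
(such `Q` is determined by the associated function `z ↦ Q(z, conj z)`). -/
noncomputable def harmSpaceC (n p q : ℕ) : Submodule ℂ (MvPolynomial (Fin n ⊕ Fin n) ℂ) :=
  LinearMap.ker (mixedLaplacianC n)
    ⊓ MvPolynomial.weightedHomogeneousSubmodule ℂ (Sum.elim (fun _ => (1 : ℕ)) fun _ => 0) p
    ⊓ MvPolynomial.weightedHomogeneousSubmodule ℂ (Sum.elim (fun _ => (0 : ℕ)) fun _ => 1) q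

/-- Exponents of monomials in two blocks of variables, whose degrees in the two blocks are
`p - i` and `q - i` without truncation. -/
def bidegreeSet (ι : Type*) [Fintype ι] (i p q : ℕ) : Set (ι ⊕ ι →₀ ℕ) :=
  {d | ∑ j, d (Sum.inl j) + i = p ∧ ∑ j, d (Sum.inr j) + i = q}

/-- Exponents of fixed block degrees are pairs of functions of fixed sums. -/
noncomputable def bidegreeSetEquiv (ι : Type*) [Fintype ι] (i p q : ℕ) :
    bidegreeSet ι i p q ≃ {x : ι → ℕ // ∑ j, x j + i = p} × {y : ι → ℕ // ∑ j, y j + i = q} :=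
  ((Finsupp.equivFunOnFinite.trans (Equiv.sumArrowEquivProdArrow ι ι ℕ)).subtypeEquiv
    (fun _ => Iff.rfl)).trans
    (Equiv.subtypeProdEquivProd (p := fun x : ι → ℕ => ∑ j, x j + i = p)
      (q := fun y : ι → ℕ => ∑ j, y j + i = q))

theorem finite_sum_add_eq (ι : Type*) [Fintype ι] (i k : ℕ) :
    Finite {x : ι → ℕ // ∑ j, x j + i = k} := by
  classical
  have : Finite {x : ι → ℕ // ∑ j, x j = k - i} := .of_equiv _ (Sym.equivNatSumOfFintype ι (k - i))
  exact .of_injective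
    (fun x : {x : ι → ℕ // ∑ j, x j + i = k} =>
      (⟨x.1, by have := x.2; omega⟩ : {x : ι → ℕ // ∑ j, x j = k - i}))
    fun x y h => Subtype.ext (congrArg (fun z => z.1) h)

instance (ι : Type*) [Fintype ι] (i p q : ℕ) : Finite (bidegreeSet ι i p q) :=
  have := finite_sum_add_eq ι i p
  have := finite_sum_add_eq ι i q
  .of_equiv _ (bidegreeSetEquiv ι i p q).symm

theorem card_sum_eq (m k : ℕ) :
    Nat.card {x : Fin (m + 1) → ℕ // ∑ j, x j = k} = (k + m).choose m := by
  rw [Nat.card_congr (Sym.equivNatSumOfFintype (Fin (m + 1)) k).symm, Nat.card_eq_fintype_card,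
    Sym.card_sym_eq_choose, Fintype.card_fin, Nat.add_right_comm, Nat.add_sub_cancel,
    Nat.add_comm, Nat.choose_symm_add]

theorem card_sum_add_one_eq (m k : ℕ) :
    Nat.card {x : Fin (m + 2) → ℕ // ∑ j, x j + 1 = k} = (k + m).choose (m + 1) := by
  cases k with
  | zero => simp
  | succ k =>
    simp only [Nat.add_right_cancel_iff]
    rw [card_sum_eq, Nat.add_right_comm, Nat.add_assoc]

theorem weight_sumElim_one_zero {ι : Type*} [Fintype ι] (d : ι ⊕ ι →₀ ℕ) :
    Finsupp.weight (Sum.elim (fun _ => (1 : ℕ)) fun _ => 0) d = ∑ j, d (Sum.inl j) := by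
  simp [Finsupp.weight_eq_sum]

theorem weight_sumElim_zero_one {ι : Type*} [Fintype ι] (d : ι ⊕ ι →₀ ℕ) :
    Finsupp.weight (Sum.elim (fun _ => (0 : ℕ)) fun _ => 1) d = ∑ j, d (Sum.inr j) := by
  simp [Finsupp.weight_eq_sum]

theorem mem_restrictSupport_iff_coeff {σ R : Type*} [CommSemiring R] {s : Set (σ →₀ ℕ)}
    {f : MvPolynomial σ R} : f ∈ restrictSupport R s ↔ ∀ d, coeff d f ≠ 0 → d ∈ s := by
  simp [mem_restrictSupport_iff, Set.subset_def]

theorem harmSpaceC_eq (n p q : ℕ) :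
    harmSpaceC n p q =
      restrictSupport ℂ (bidegreeSet (Fin n) 0 p q) ⊓ LinearMap.ker (mixedLaplacianC n) := by
  ext f
  simp only [harmSpaceC, Submodule.mem_inf, mem_weightedHomogeneousSubmodule,
    IsWeightedHomogeneous, weight_sumElim_one_zero, weight_sumElim_zero_one,
    mem_restrictSupport_iff_coeff, bidegreeSet, Set.mem_ofPred_eq, add_zero]
  grind

/-- The change of the block degrees of an exponent under `∂²/∂u_j∂v_j`. -/
theorem add_single_mem_bidegreeSet_iff {ι : Type*} [Fintype ι] (d : ι ⊕ ι →₀ ℕ) (j : ι)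
    (i p q : ℕ) :
    d + Finsupp.single (Sum.inl j) 1 + Finsupp.single (Sum.inr j) 1 ∈ bidegreeSet ι i p q ↔
      d ∈ bidegreeSet ι (i + 1) p q := by
  classical
  simp [bidegreeSet, Finset.sum_add_distrib, Finsupp.single_apply, add_assoc, add_comm]

theorem mixedLaplacianC_apply (n : ℕ) (f : MvPolynomial (Fin n ⊕ Fin n) ℂ) :
    mixedLaplacianC n f = ∑ j, pderiv (Sum.inl j) (pderiv (Sum.inr j) f) := by
  simp [mixedLaplacianC]

theorem coeff_mixedLaplacianC (n : ℕ) (f : MvPolynomial (Fin n ⊕ Fin n) ℂ)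
    (d : Fin n ⊕ Fin n →₀ ℕ) :
    coeff d (mixedLaplacianC n f) =
      ∑ j, coeff (d + Finsupp.single (Sum.inl j) 1 + Finsupp.single (Sum.inr j) 1) f *
        (d (Sum.inr j) + 1) * (d (Sum.inl j) + 1) := by
  simp [mixedLaplacianC_apply, coeff_sum, coeff_pderiv]

theorem mixedLaplacianC_mem (n p q : ℕ) {f : MvPolynomial (Fin n ⊕ Fin n) ℂ}
    (hf : f ∈ restrictSupport ℂ (bidegreeSet (Fin n) 0 p q)) :
    mixedLaplacianC n f ∈ restrictSupport ℂ (bidegreeSet (Fin n) 1 p q) := by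
  rw [mem_restrictSupport_iff_coeff] at hf ⊢
  intro d hd
  rw [coeff_mixedLaplacianC] at hd
  obtain ⟨j, -, hj⟩ := Finset.exists_ne_zero_of_sum_ne_zero hd
  exact (add_single_mem_bidegreeSet_iff d j 0 p q).1
    (hf _ (left_ne_zero_of_mul (left_ne_zero_of_mul hj)))

theorem pderiv_pderiv_monomial_add {ι : Type*} [DecidableEq ι] (d : ι ⊕ ι →₀ ℕ) (j k : ι)
    (hjk : j ≠ k) (c : ℂ) :
    pderiv (Sum.inl j) (pderiv (Sum.inr j) (monomial
      (d + Finsupp.single (Sum.inl k) 1 + Finsupp.single (Sum.inr k) 1) c)) =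
    monomial (d - Finsupp.single (Sum.inl j) 1 - Finsupp.single (Sum.inr j) 1 +
      Finsupp.single (Sum.inl k) 1 + Finsupp.single (Sum.inr k) 1)
      (c * d (Sum.inr j) * d (Sum.inl j)) := by
  have h : d + Finsupp.single (Sum.inl k) 1 + Finsupp.single (Sum.inr k) 1 -
      Finsupp.single (Sum.inr j) 1 - Finsupp.single (Sum.inl j) 1 =
      d - Finsupp.single (Sum.inl j) 1 - Finsupp.single (Sum.inr j) 1 +
        Finsupp.single (Sum.inl k) 1 + Finsupp.single (Sum.inr k) 1 := by
    ext x
    rcases x with x | x <;> simp [Finsupp.single_apply] <;> grind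
  rw [pderiv_monomial, pderiv_monomial, h]
  congr 1
  simp [hjk.symm]

/-- By induction on the defect of the degree in one variable: `∂²/∂u_k∂v_k` has an explicit right
inverse on monomials, and the remaining terms of the Laplacian increase the degree in `u_k`. -/
theorem monomial_mem_map_mixedLaplacianC (n p q : ℕ) (k : Fin n) (N : ℕ) :
    ∀ d ∈ bidegreeSet (Fin n) 1 p q, p ≤ d (Sum.inl k) + N → ∀ c : ℂ,
      monomial d c ∈
        (restrictSupport ℂ (bidegreeSet (Fin n) 0 p q)).map (mixedLaplacianC n) := by
  induction N with
  | zero =>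
    intro d hd hN
    have hle : d (Sum.inl k) ≤ ∑ j, d (Sum.inl j) :=
      Finset.single_le_sum (f := fun j => d (Sum.inl j)) (fun _ _ => Nat.zero_le _)
        (Finset.mem_univ k)
    have := hd.1
    omega
  | succ N ih =>
    intro d hd hN c
    set b : ℂ := c / ((d (Sum.inr k) + 1) * (d (Sum.inl k) + 1)) with hb
    have hbc : b * (d (Sum.inr k) + 1) * (d (Sum.inl k) + 1) = c := by
      rw [hb, mul_assoc]
      exact div_mul_cancel₀ _ (mul_ne_zero (Nat.cast_add_one_ne_zero _) (Nat.cast_add_one_ne_zero _))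
    set f : MvPolynomial (Fin n ⊕ Fin n) ℂ :=
      monomial (d + Finsupp.single (Sum.inl k) 1 + Finsupp.single (Sum.inr k) 1) b with hf
    have hfmem : f ∈ restrictSupport ℂ (bidegreeSet (Fin n) 0 p q) := by
      rw [mem_restrictSupport_iff_coeff]
      intro e he
      rw [hf, coeff_monomial] at he
      rw [← (ite_ne_right_iff.1 he).1, add_single_mem_bidegreeSet_iff]
      exact hd
    have hk : pderiv (Sum.inl k) (pderiv (Sum.inr k) f) = monomial d c := by
      rw [hf, pderiv_monomial, pderiv_monomial, add_tsub_cancel_right, add_tsub_cancel_right]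
      simp [← hbc]
    have hsum : mixedLaplacianC n f = monomial d c +
        ∑ j ∈ Finset.univ.erase k, pderiv (Sum.inl j) (pderiv (Sum.inr j) f) := by
      rw [mixedLaplacianC_apply, ← Finset.add_sum_erase _ _ (Finset.mem_univ k), hk]
    rw [← sub_eq_of_eq_add hsum]
    refine Submodule.sub_mem _ (Submodule.mem_map_of_mem hfmem)
      (Submodule.sum_mem _ fun j hj => ?_)
    have hjk : j ≠ k := Finset.ne_of_mem_erase hj
    rw [hf, pderiv_pderiv_monomial_add d j k hjk]
    by_cases hr : d (Sum.inr j) = 0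
    · simp [hr]
    by_cases hl : d (Sum.inl j) = 0
    · simp [hl]
    refine ih _ ?_ ?_ _
    · have hd' : d - Finsupp.single (Sum.inl j) 1 - Finsupp.single (Sum.inr j) 1 +
          Finsupp.single (Sum.inl j) 1 + Finsupp.single (Sum.inr j) 1 = d := by
        ext x
        rcases x with x | x <;> simp [Finsupp.single_apply] <;> grind
      rw [add_single_mem_bidegreeSet_iff, ← add_single_mem_bidegreeSet_iff _ j, hd']
      exact hd
    · simp [hjk]
      omega

theorem map_mixedLaplacianC (n p q : ℕ) (k : Fin n) :
    (restrictSupport ℂ (bidegreeSet (Fin n) 0 p q)).map (mixedLaplacianC n) =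
      restrictSupport ℂ (bidegreeSet (Fin n) 1 p q) := by
  apply le_antisymm
  · rintro _ ⟨f, hf, rfl⟩
    exact mixedLaplacianC_mem n p q hf
  · rw [restrictSupport_eq_span, Submodule.span_le]
    rintro _ ⟨d, hd, rfl⟩
    exact monomial_mem_map_mixedLaplacianC n p q k p d hd (Nat.le_add_left _ _) 1

theorem finrank_restrictSupport {σ : Type*} (s : Set (σ →₀ ℕ)) :
    Module.finrank ℂ (restrictSupport ℂ s) = Nat.card s :=
  Module.finrank_eq_nat_card_basis (basisRestrictSupport ℂ s)

instance (n p q : ℕ) : FiniteDimensional ℂ (restrictSupport ℂ (bidegreeSet (Fin n) 0 p q)) :=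
  Module.Finite.of_basis (basisRestrictSupport ℂ _)

theorem finrank_harmSpaceC_add (n p q : ℕ) (k : Fin n) :
    Nat.card (bidegreeSet (Fin n) 1 p q) + Module.finrank ℂ (harmSpaceC n p q) =
      Nat.card (bidegreeSet (Fin n) 0 p q) := by
  have h := ((mixedLaplacianC n).domRestrict
    (restrictSupport ℂ (bidegreeSet (Fin n) 0 p q))).finrank_range_add_finrank_ker
  rw [LinearMap.range_domRestrict, map_mixedLaplacianC n p q k, LinearMap.ker_domRestrict,
    finrank_restrictSupport, finrank_restrictSupport, ← Submodule.finrank_map_subtype_eq,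
    Submodule.map_comap_subtype, ← harmSpaceC_eq] at h
  exact h

theorem add_one_mul_choose_succ (m k : ℕ) :
    (m + 1) * (k + m).choose (m + 1) = k * (k + m).choose m := by
  have := Nat.choose_succ_right_eq (k + m) m
  rw [Nat.add_sub_cancel] at this
  linarith

/-- For `n ≥ 2` and `p, q ∈ ℕ`, the space `H_{p,q}(ℂⁿ)` of harmonic polynomials of bidegree
`(p,q)` is finite dimensional with dimension `d` satisfying
`(n−1)·d = (p+q+n−1)·C(p+n−2, n−2)·C(q+n−2, n−2)`. -/
theorem finrank_harmSpaceC (n p q : ℕ) (hn : 2 ≤ n) :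
    FiniteDimensional ℂ (harmSpaceC n p q) ∧
    (n - 1) * Module.finrank ℂ (harmSpaceC n p q)
      = (p + q + n - 1) * Nat.choose (p + n - 2) (n - 2) * Nat.choose (q + n - 2) (n - 2) := by
  rw [harmSpaceC_eq]
  refine ⟨Submodule.finiteDimensional_inf_left _ _, ?_⟩
  rw [← harmSpaceC_eq]
  obtain ⟨m, rfl⟩ := Nat.exists_eq_add_of_le' hn
  have h := finrank_harmSpaceC_add (m + 2) p q 0
  rw [Nat.card_congr (bidegreeSetEquiv _ 1 p q), Nat.card_congr (bidegreeSetEquiv _ 0 p q),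
    Nat.card_prod, Nat.card_prod] at h
  simp only [add_zero] at h
  rw [card_sum_add_one_eq, card_sum_add_one_eq, card_sum_eq, card_sum_eq, ← Nat.add_assoc,
    ← Nat.add_assoc, Nat.choose_succ_succ, Nat.choose_succ_succ] at h
  have hp := add_one_mul_choose_succ m p
  have hq := add_one_mul_choose_succ m q
  rw [show m + 2 - 1 = m + 1 by omega, show p + q + (m + 2) - 1 = p + q + (m + 1) by omega,
    show p + (m + 2) - 2 = p + m by omega, show q + (m + 2) - 2 = q + m by omega,
    show m + 2 - 2 = m by omega]
  simp only [Nat.succ_eq_add_one] at h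
  zify at h hp hq ⊢
  linear_combination (m + 1 : ℤ) * h + ((q + m).choose m : ℤ) * hp + ((p + m).choose m : ℤ) * hq
end

section
/- Let κ ∈ ℤ and let t, t', s ∈ ℂ satisfy Re(s + t + t' + |κ|/2) > 0. Then (2/π) · ∫_{ℂ∖{0}} χ(x)^κ · (x·conj x)^{t+t'+s−1} · (conj x)^{max(κ,0)} · x^{max(−κ,0)} · exp(−2π·x·conj x) dx = 2·(2π)^{−(s+t+t'+|κ|/2)} · Γ(s+t+t'+|κ|/2), where the integral is with respect to Lebesgue measure on ℂ ≅ ℝ², χ(x) := x/|x| is the unit complex number in the direction of x (so χ(x)^κ = e^{iκ·arg x}), and (x·conj x)^w denotes the complex power of the positive real number x·conj x. That is, the GL₁×GL₁ Rankin–Selberg (Tate) integral over ℂ — with Whittaker newform W°(x) = χ(x)^κ·(x·conj x)^t of the character π = χ^κ·|·|_ℂ^t of ℂˣ (where |x|_ℂ := x·conj x), spherical Whittaker function W'°(x) = (x·conj x)^{t'} of π' = |·|_ℂ^{t'}, Schwartz function Φ°(x) = conj(P°(x))·exp(−2π·x·conj x) with P°(x) = x^{max(κ,0)}·(conj x)^{max(−κ,0)},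 and multiplicative Haar measure d×x = (1/π)·|x|_ℂ^{−1}·(2·dLeb) — equals the Rankin–Selberg L-function L(s, π × π') = ζ_ℂ(s+t+t'+|κ|/2). -/
open MeasureTheory

/-- A radial function of `‖x‖ ^ 2` on `ℂ` integrates to `π` times its integral over `(0, ∞)`. -/
theorem Complex.integral_fun_norm_sq {E : Type*} [NormedAddCommGroup E] [NormedSpace ℝ E]
    (g : ℝ → E) :
    ∫ x : ℂ, g (‖x‖ ^ 2) = Real.pi • ∫ u in Set.Ioi (0 : ℝ), g u := by
  rw [integral_fun_norm_addHaar (volume : Measure ℂ) (fun r => g (r ^ 2)),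
    ← integral_comp_rpow_Ioi_of_pos (g := g) (p := 2) two_pos, measureReal_def,
    Complex.volume_ball, Complex.finrank_real_complex]
  have h : ∫ x in Set.Ioi (0 : ℝ), ((2 : ℝ) * x ^ ((2 : ℝ) - 1)) • g (x ^ (2 : ℝ)) =
      (2 : ℝ) • ∫ x in Set.Ioi (0 : ℝ), x ^ (2 - 1) • g (x ^ 2) := by
    rw [← integral_smul]
    refine setIntegral_congr_fun measurableSet_Ioi fun x _ => ?_
    norm_num [smul_smul]
  rw [h, smul_comm Real.pi (2 : ℝ), ← Nat.cast_smul_eq_nsmul ℝ]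
  simp

/-- On `ℂ ∖ {0}`, the product `χ(x) ^ κ * conj P°(x)` is `|x|_ℂ ^ (|κ| / 2)`. -/
theorem Complex.div_norm_zpow_mul_conj_zpow_mul_zpow {x : ℂ} (hx : x ≠ 0) (κ : ℤ) :
    (x / (‖x‖ : ℂ)) ^ κ * ((starRingEnd ℂ) x) ^ (max κ 0) * x ^ (max (-κ) 0) =
      ((‖x‖ ^ 2 : ℝ) : ℂ) ^ (((|κ| : ℤ) : ℂ) / 2) := by
  have hn : (‖x‖ : ℂ) ≠ 0 := by simpa using hx
  have hpow : ((‖x‖ ^ 2 : ℝ) : ℂ) ^ (((|κ| : ℤ) : ℂ) / 2) = (‖x‖ : ℂ) ^ |κ| := by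
    rw [Complex.ofReal_pow, ← Complex.cpow_nat_mul' (n := 2)
      (by rw [Complex.arg_ofReal_of_nonneg (norm_nonneg x)]; simpa using Real.pi_pos)
      (by rw [Complex.arg_ofReal_of_nonneg (norm_nonneg x)]; simpa using Real.pi_pos.le),
      ← Complex.cpow_intCast]
    congr 1
    push_cast
    ring
  rw [hpow]
  rcases le_total 0 κ with h | h
  · rw [max_eq_left h, max_eq_right (by lia), abs_of_nonneg h, zpow_zero, mul_one, ← mul_zpow]
    congr 1
    rw [div_mul_eq_mul_div, Complex.mul_conj', sq, mul_div_cancel_right₀ _ hn]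
  · rw [max_eq_right h, max_eq_left (by lia), abs_of_nonpos h, zpow_zero, mul_one, div_zpow,
      div_mul_eq_mul_div, zpow_neg, mul_inv_cancel₀ (zpow_ne_zero _ hx), one_div, ← zpow_neg]

/-- **The GL₁ × GL₁ Rankin–Selberg (Tate) integral over ℂ.** For `κ ∈ ℤ` and
`t, t', s ∈ ℂ` with `Re(s + t + t' + |κ|/2) > 0`,
`(2/π) · ∫_{ℂ∖{0}} χ(x)^κ · (x·conj x)^{t+t'+s−1} · (conj x)^{max(κ,0)} · x^{max(−κ,0)}
    · exp(−2π·x·conj x) dx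
  = 2·(2π)^{−(s+t+t'+|κ|/2)} · Γ(s+t+t'+|κ|/2) = ζ_ℂ(s+t+t'+|κ|/2) = L(s, π × π')`,
where `χ(x) = x/|x|` is the unit complex number in the direction of `x`, the integral is
with respect to Lebesgue measure on `ℂ ≅ ℝ²`, and `(x·conj x)^w` is the complex power of
the positive real number `x·conj x`. -/
theorem tate_integral_complex (κ : ℤ) (t t' s : ℂ)
    (hs : 0 < (s + t + t' + ((|κ| : ℤ) : ℂ) / 2).re) :
    (2 / (Real.pi : ℂ)) *
        ∫ x in ({0}ᶜ : Set ℂ),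
          (x / (‖x‖ : ℂ)) ^ κ * (x * (starRingEnd ℂ) x) ^ (t + t' + s - 1) *
            ((starRingEnd ℂ) x) ^ (max κ 0) * x ^ (max (-κ) 0) *
            Complex.exp (-(2 * (Real.pi : ℂ)) * (x * (starRingEnd ℂ) x))
      = 2 * (2 * (Real.pi : ℂ)) ^ (-(s + t + t' + ((|κ| : ℤ) : ℂ) / 2)) *
          Complex.Gamma (s + t + t' + ((|κ| : ℤ) : ℂ) / 2) := by
  set w : ℂ := s + t + t' + ((|κ| : ℤ) : ℂ) / 2 with hw
  have hcongr : ∀ x ∈ ({0}ᶜ : Set ℂ),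
      (x / (‖x‖ : ℂ)) ^ κ * (x * (starRingEnd ℂ) x) ^ (t + t' + s - 1) *
            ((starRingEnd ℂ) x) ^ (max κ 0) * x ^ (max (-κ) 0) *
            Complex.exp (-(2 * (Real.pi : ℂ)) * (x * (starRingEnd ℂ) x)) =
        (fun u : ℝ => (u : ℂ) ^ (w - 1) * Complex.exp (-(((2 * Real.pi : ℝ) : ℂ) * u)))
          (‖x‖ ^ 2) := by
    intro x hx
    have hx0 : x ≠ 0 := hx
    have hu : ((‖x‖ ^ 2 : ℝ) : ℂ) ≠ 0 := by simpa using hx0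
    have hconj : x * (starRingEnd ℂ) x = ((‖x‖ ^ 2 : ℝ) : ℂ) := by
      rw [Complex.mul_conj', Complex.ofReal_pow]
    have hexp : w - 1 = ((|κ| : ℤ) : ℂ) / 2 + (t + t' + s - 1) := by rw [hw]; ring
    simp only [hconj]
    rw [hexp, Complex.cpow_add _ _ hu, ← Complex.div_norm_zpow_mul_conj_zpow_mul_zpow hx0 κ,
      neg_mul, Complex.ofReal_mul, Complex.ofReal_ofNat]
    ring
  have hpi : (Real.pi : ℂ) ≠ 0 := Complex.ofReal_ne_zero.mpr Real.pi_ne_zero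
  have hinv : (1 / ((2 * Real.pi : ℝ) : ℂ)) ^ w = (2 * (Real.pi : ℂ)) ^ (-w) := by
    rw [one_div, Complex.inv_cpow, ← Complex.cpow_neg, Complex.ofReal_mul, Complex.ofReal_ofNat]
    rw [Complex.arg_ofReal_of_nonneg (by positivity)]
    exact Real.pi_ne_zero.symm
  rw [setIntegral_congr_fun (measurableSet_singleton (0 : ℂ)).compl hcongr,
    restrict_compl_singleton, Complex.integral_fun_norm_sq
      (fun u : ℝ => (u : ℂ) ^ (w - 1) * Complex.exp (-(((2 * Real.pi : ℝ) : ℂ) * u))),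
    Complex.integral_cpow_mul_exp_neg_mul_Ioi hs Real.two_pi_pos, hinv, Complex.real_smul]
  field_simp
end
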